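/- arXiv:1501.00251 — 2 statements merged into one kernel-verified Lean document; each statement's English description precedes it below -/
import Mathlib

section
/- Let α ∈ (0,1). Then lim_{t→+∞} t · E_{α,1}(−t) = 1/Γ(1−α); that is, the Mittag-Leffler function E_{α,1} decays only linearly (like 1/(Γ(1−α) t)) on the negative real axis, in contrast with the exponential decay of e^{−t}. -/
open scoped Real

/-- Two-parameter Mittag-Leffler function (complex argument). -/
noncomputable def mlC (a b : ℝ) (z : ℂ) : ℂ :=
  ∑' k : ℕ, z ^ k / Complex.Gamma (((k : ℝ) * a + b : ℝ) : ℂ)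

/-- Two-parameter Mittag-Leffler function (real argument). -/
noncomputable def mlR (a b : ℝ) (x : ℝ) : ℝ :=
  ∑' k : ℕ, x ^ k / Real.Gamma ((k : ℝ) * a + b)

/-- Wright function (real argument). -/
noncomputable def wrightR (p m : ℝ) (x : ℝ) : ℝ :=
  ∑' k : ℕ, x ^ k / ((k.factorial : ℝ) * Real.Gamma (p * (k : ℝ) + m))

/-- Djrbashian-Caputo fractional derivative of order `g ∈ (0,1)` (real-valued). -/
noncomputable def caputoR (g : ℝ) (f : ℝ → ℝ) (t : ℝ) : ℝ :=
  (1 / Real.Gamma (1 - g)) * ∫ s in (0:ℝ)..t, (t - s) ^ (-g) * deriv f s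

/-- Djrbashian-Caputo fractional derivative of order `b ∈ (1,2)` (complex-valued). -/
noncomputable def caputoC2 (b : ℝ) (f : ℝ → ℂ) (x : ℝ) : ℂ :=
  (1 / Complex.Gamma ((2 - b : ℝ) : ℂ)) *
    ∫ s in (0:ℝ)..x, (((x - s) ^ (1 - b) : ℝ) : ℂ) * deriv (deriv f) s

/-- Riemann–Liouville fractional derivative of order `b ∈ (1,2)` (complex-valued). -/
noncomputable def rlC2 (b : ℝ) (f : ℝ → ℂ) (x : ℝ) : ℂ :=
  deriv (deriv (fun y : ℝ =>
    (1 / Complex.Gamma ((2 - b : ℝ) : ℂ)) *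
      ∫ s in (0:ℝ)..y, (((y - s) ^ (1 - b) : ℝ) : ℂ) * f s)) x

open MeasureTheory Filter Topology Set

theorem differentiableOn_integral_of_norm_le {β : Type*} [MeasurableSpace β] {μ : Measure β}
    {F : ℂ → β → ℂ} {U : Set ℂ} (hU : IsOpen U) {bound : β → ℝ}
    (hmeas : ∀ z ∈ U, AEStronglyMeasurable (F z) μ)
    (hdiff : ∀ b, DifferentiableOn ℂ (fun z => F z b) U)
    (hint : Integrable bound μ) (hle : ∀ z ∈ U, ∀ b, ‖F z b‖ ≤ bound b) :
    DifferentiableOn ℂ (fun z => ∫ b, F z b ∂μ) U := by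
  intro z hz
  obtain ⟨r, hr, hball⟩ := Metric.isOpen_iff.1 hU z hz
  have hsub : ∀ w ∈ Metric.ball z (r / 2), Metric.closedBall w (r / 4) ⊆ U := by
    intro w hw v hv
    apply hball
    rw [Metric.mem_ball] at hw ⊢
    rw [Metric.mem_closedBall] at hv
    linarith [dist_triangle v w z]
  have hda : ∀ b, ∀ w ∈ Metric.ball z (r / 2),
      HasDerivAt (fun z => F z b) (deriv (fun z => F z b) w) w := by
    intro b w hw
    have hwU : w ∈ U := hsub w hw (Metric.mem_closedBall_self (by positivity))
    exact ((hdiff b).differentiableAt (hU.mem_nhds hwU)).hasDerivAt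
  have hzb : z ∈ Metric.ball z (r / 2) := Metric.mem_ball_self (by positivity)
  have hmeas' : AEStronglyMeasurable (fun b => deriv (fun z => F z b) z) μ := by
    have hseq : Tendsto (fun n : ℕ => z + (((r / 2) / ((n : ℝ) + 2) : ℝ) : ℂ)) atTop (𝓝[≠] z) := by
      rw [tendsto_nhdsWithin_iff]
      constructor
      · have h1 : Tendsto (fun n : ℕ => (r / 2) / ((n : ℝ) + 2)) atTop (𝓝 0) :=
          tendsto_const_nhds.div_atTop
            (tendsto_atTop_add_const_right _ _ tendsto_natCast_atTop_atTop)
        have h2 := (Complex.continuous_ofReal.tendsto 0).comp h1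
        simpa using h2.const_add z
      · refine Eventually.of_forall fun n => ?_
        have : (r / 2) / ((n : ℝ) + 2) ≠ 0 := by positivity
        simpa only [mem_compl_iff, mem_singleton_iff, add_eq_left, Complex.ofReal_eq_zero] using this
    refine aestronglyMeasurable_of_tendsto_ae atTop
      (f := fun n : ℕ => fun b => slope (fun z => F z b) z (z + (((r / 2) / ((n : ℝ) + 2) : ℝ) : ℂ)))
      (fun n => ?_) (Eventually.of_forall fun b => ?_)
    · simp only [slope_def_module]
      refine ((hmeas _ ?_).sub (hmeas _ hz)).const_smul
        ((z + (((r / 2) / ((n : ℝ) + 2) : ℝ) : ℂ)) - z)⁻¹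
      apply hball
      have h0 : 0 ≤ (r / 2) / ((n : ℝ) + 2) := by positivity
      rw [Metric.mem_ball, dist_eq_norm, add_sub_cancel_left, Complex.norm_real, Real.norm_eq_abs,
        abs_of_nonneg h0]
      have : (r / 2) / ((n : ℝ) + 2) ≤ (r / 2) := div_le_self (by positivity) (by
        have : (0 : ℝ) ≤ n := by positivity
        linarith)
      linarith
    · exact (hasDerivAt_iff_tendsto_slope.1 (hda b z hzb)).comp hseq
  have := (hasDerivAt_integral_of_dominated_loc_of_deriv_le (μ := μ) (F := F)
    (F' := fun w b => deriv (fun z => F z b) w) (bound := fun b => bound b / (r / 4))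
    (Metric.ball_mem_nhds z (by positivity : 0 < r / 2))
    (by filter_upwards [hU.mem_nhds hz] with w hw using hmeas w hw)
    (hint.mono' (hmeas z hz) (Eventually.of_forall (hle z hz))) hmeas'
    (Eventually.of_forall fun b w hw => ?_) (hint.div_const _)
    (Eventually.of_forall hda)).2
  · exact this.differentiableAt.differentiableWithinAt
  · refine Complex.norm_deriv_le_of_forall_mem_sphere_norm_le (by positivity) ?_ fun v hv =>
      hle v (hsub w hw (Metric.sphere_subset_closedBall hv)) b
    exact ((hdiff b).mono (hsub w hw)).diffContOnCl_ball subset_rfl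

theorem norm_ofReal_cpow_mul_exp {a t : ℝ} (ht : 0 < t) (r : ℂ) :
    ‖(t : ℂ) ^ ((a : ℂ) - 1) * Complex.exp (-(r * t))‖ = t ^ (a - 1) * Real.exp (-(r.re * t)) := by
  rw [norm_mul, Complex.norm_cpow_eq_rpow_re_of_pos ht, Complex.norm_exp]
  simp

theorem integrableOn_rpow_mul_exp_neg_mul {a b : ℝ} (ha : 0 < a) (hb : 0 < b) :
    IntegrableOn (fun t : ℝ => t ^ (a - 1) * Real.exp (-(b * t))) (Ioi 0) := by
  simpa [Real.rpow_one, neg_mul] using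
    integrableOn_rpow_mul_exp_neg_mul_rpow (s := a - 1) (p := 1) (by linarith) one_pos hb

theorem aestronglyMeasurable_cpow_mul_exp (a r : ℂ) :
    AEStronglyMeasurable (fun t : ℝ => (t : ℂ) ^ a * Complex.exp (-(r * t)))
      (volume.restrict (Ioi 0)) := by
  refine ContinuousOn.aestronglyMeasurable (fun t ht => ?_) measurableSet_Ioi
  refine ContinuousAt.continuousWithinAt (ContinuousAt.mul ?_ (by fun_prop))
  exact Complex.continuousAt_ofReal_cpow_const _ _ (Or.inr (ne_of_gt ht))

/-- The Euler integral with a complex rate. -/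
theorem integral_cpow_mul_exp_neg_complex_mul_Ioi {a : ℝ} (ha : 0 < a) {r : ℂ}
    (hr : 1 / 2 < r.re) :
    ∫ t in Ioi (0 : ℝ), (t : ℂ) ^ ((a : ℂ) - 1) * Complex.exp (-(r * t)) =
      r ^ (-(a : ℂ)) * Complex.Gamma a := by
  have hU : IsOpen {z : ℂ | 1 / 2 < z.re} := isOpen_lt continuous_const Complex.continuous_re
  have hc : IsPreconnected {z : ℂ | 1 / 2 < z.re} :=
    (convex_halfSpace_re_gt (1 / 2)).isPreconnected
  have h1 : DifferentiableOn ℂ (fun r : ℂ => ∫ t in Ioi (0 : ℝ),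
      (t : ℂ) ^ ((a : ℂ) - 1) * Complex.exp (-(r * t))) {z : ℂ | 1 / 2 < z.re} := by
    have hd : DifferentiableOn ℂ (fun r : ℂ => ∫ t in Ioi (0 : ℝ),
      (Ioi (0 : ℝ)).indicator (fun t : ℝ => (t : ℂ) ^ ((a : ℂ) - 1) * Complex.exp (-(r * t))) t)
        {z : ℂ | 1 / 2 < z.re} := by
      refine differentiableOn_integral_of_norm_le hU
        (bound := (Ioi (0 : ℝ)).indicator fun t : ℝ => t ^ (a - 1) * Real.exp (-(1 / 2 * t)))
        (fun z _ => (aestronglyMeasurable_cpow_mul_exp _ z).indicator measurableSet_Ioi) (fun t => ?_)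
        ((integrableOn_rpow_mul_exp_neg_mul ha (by norm_num)).indicator measurableSet_Ioi)
        (fun z hz t => ?_)
      · by_cases ht : t ∈ Ioi (0 : ℝ)
        · simp only [indicator_of_mem ht]; fun_prop
        · simp only [indicator_of_notMem ht]; fun_prop
      · by_cases ht : t ∈ Ioi (0 : ℝ)
        · simp only [indicator_of_mem ht]
          rw [norm_ofReal_cpow_mul_exp ht]
          have : (0 : ℝ) < t := ht
          have hz' : 1 / 2 < z.re := hz
          gcongr
        · simp only [indicator_of_notMem ht, norm_zero, le_refl]
    refine hd.congr fun z _ => setIntegral_congr_fun measurableSet_Ioi fun t ht => ?_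
    simp only [indicator_of_mem ht]
  have h2 : DifferentiableOn ℂ (fun r : ℂ => r ^ (-(a : ℂ)) * Complex.Gamma a)
      {z : ℂ | 1 / 2 < z.re} := by
    intro z hz
    have hz' : 1 / 2 < z.re := hz
    refine DifferentiableAt.differentiableWithinAt (DifferentiableAt.mul_const ?_ _)
    exact differentiableAt_id.cpow_const (Or.inl (by simp only [id]; linarith))
  refine (h1.analyticOnNhd hU).eqOn_of_preconnected_of_frequently_eq (h2.analyticOnNhd hU) hc
    (z₀ := 1) (by norm_num) ?_ hr
  have hseq : Tendsto (fun n : ℕ => ((1 + 1 / ((n : ℝ) + 1) : ℝ) : ℂ)) atTop (𝓝[≠] 1) := by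
    rw [tendsto_nhdsWithin_iff]
    constructor
    · have h3 := (tendsto_one_div_add_atTop_nhds_zero_nat (𝕜 := ℝ)).const_add 1
      have h4 := (Complex.continuous_ofReal.tendsto _).comp h3
      rwa [add_zero, Complex.ofReal_one] at h4
    · refine Eventually.of_forall fun n => ?_
      have h4 : 1 / ((n : ℝ) + 1) ≠ 0 := by positivity
      have h5 : (1 + 1 / ((n : ℝ) + 1)) ≠ 1 := by simpa using h4
      rw [mem_compl_iff, mem_singleton_iff, Complex.ofReal_eq_one]
      exact h5
  refine hseq.frequently (Frequently.of_forall fun n => ?_)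
  have hpos : 0 < 1 + 1 / ((n : ℝ) + 1) := by positivity
  rw [Complex.integral_cpow_mul_exp_neg_mul_Ioi (by simpa using ha) hpos, one_div,
    Complex.cpow_neg, Complex.inv_cpow]
  rw [Complex.arg_ofReal_of_nonneg hpos.le]
  exact Real.pi_ne_zero.symm

/-- The vertical line `Re s = 1`. -/
noncomputable def verticalLine (w : ℝ) : ℂ := 1 + ((2 * π * w : ℝ) : ℂ) * Complex.I

theorem verticalLine_re (w : ℝ) : (verticalLine w).re = 1 := by simp [verticalLine]

theorem verticalLine_mem_slitPlane (w : ℝ) : verticalLine w ∈ Complex.slitPlane :=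
  Or.inl (by rw [verticalLine_re]; exact one_pos)

theorem verticalLine_ne_zero (w : ℝ) : verticalLine w ≠ 0 :=
  Complex.slitPlane_ne_zero (verticalLine_mem_slitPlane w)

@[fun_prop]
theorem continuous_verticalLine : Continuous verticalLine := by
  unfold verticalLine; fun_prop

theorem continuous_verticalLine_cpow (a : ℂ) : Continuous fun w => verticalLine w ^ a :=
  continuous_verticalLine.cpow continuous_const verticalLine_mem_slitPlane

theorem one_add_sq_le_norm_verticalLine_sq (w : ℝ) : 1 + ‖w‖ ^ 2 ≤ ‖verticalLine w‖ ^ 2 := by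
  have : ‖verticalLine w‖ ^ 2 = 1 + (2 * π * w) ^ 2 := by
    rw [← Complex.normSq_eq_norm_sq, Complex.normSq_apply]
    simp [verticalLine]
    ring
  rw [this, Real.norm_eq_abs, sq_abs]
  have h3 := Real.pi_gt_three
  nlinarith [mul_nonneg (mul_nonneg (by linarith : (0 : ℝ) ≤ π - 3) (by linarith : (0 : ℝ) ≤ π + 3))
    (sq_nonneg w), sq_nonneg w]

theorem one_le_norm_verticalLine (w : ℝ) : 1 ≤ ‖verticalLine w‖ := by
  have := one_add_sq_le_norm_verticalLine_sq w
  nlinarith [norm_nonneg w, norm_nonneg (verticalLine w), sq_nonneg ‖w‖]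

theorem integrable_norm_verticalLine_rpow {z : ℝ} (hz : 1 < z) :
    Integrable fun w => ‖verticalLine w‖ ^ (-z) := by
  refine (integrable_rpow_neg_one_add_norm_sq (E := ℝ) (μ := volume) (r := z)
    (by simpa using hz)).mono' ?_ (Eventually.of_forall fun w => ?_)
  · refine Continuous.aestronglyMeasurable (continuous_verticalLine.norm.rpow_const fun w => Or.inl ?_)
    exact norm_ne_zero_iff.2 (verticalLine_ne_zero w)
  · rw [Real.norm_of_nonneg (by positivity)]
    calc ‖verticalLine w‖ ^ (-z) = (‖verticalLine w‖ ^ 2) ^ (-z / 2) := by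
          rw [← Real.rpow_natCast, ← Real.rpow_mul (norm_nonneg _)]
          congr 1; push_cast; ring
      _ ≤ (1 + ‖w‖ ^ 2) ^ (-z / 2) :=
          Real.rpow_le_rpow_of_nonpos (by positivity) (one_add_sq_le_norm_verticalLine_sq w)
            (by linarith)

/-- The inverse Laplace transform of `s ↦ s ^ (-z)` at time one. -/
theorem integral_exp_mul_verticalLine_cpow {z : ℝ} (hz : 1 < z) :
    ∫ w, Complex.exp (verticalLine w) * verticalLine w ^ (-(z : ℂ)) = (Complex.Gamma z)⁻¹ := by
  set f : ℝ → ℂ := (Ioi (0 : ℝ)).indicator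
    fun t => (t : ℂ) ^ ((z : ℂ) - 1) * Complex.exp (-(1 * t)) with hf
  have hΓ : Complex.Gamma z ≠ 0 := Complex.Gamma_ne_zero_of_re_pos (by simp; linarith)
  have hfourier : ∀ w, FourierTransform.fourier f w =
      verticalLine w ^ (-(z : ℂ)) * Complex.Gamma z := by
    intro w
    rw [Real.fourier_real_eq_integral_exp_smul,
      ← integral_cpow_mul_exp_neg_complex_mul_Ioi (by linarith : 0 < z)
        (by rw [verticalLine_re]; norm_num), ← integral_indicator measurableSet_Ioi]
    congr 1
    ext t
    by_cases ht : t ∈ Ioi (0 : ℝ)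
    · simp only [hf, indicator_of_mem ht, smul_eq_mul]
      rw [mul_left_comm, ← Complex.exp_add]
      congr 2
      simp only [verticalLine]
      push_cast
      ring
    · simp only [hf, indicator_of_notMem ht, smul_zero]
  have hfi : Integrable f := by
    refine Integrable.mono' ((integrableOn_rpow_mul_exp_neg_mul (by linarith : 0 < z)
      one_pos).integrable_indicator measurableSet_Ioi)
      ((aestronglyMeasurable_indicator_iff measurableSet_Ioi).2
        (aestronglyMeasurable_cpow_mul_exp _ _)) (Eventually.of_forall fun t => ?_)
    by_cases ht : t ∈ Ioi (0 : ℝ)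
    · simp only [hf, indicator_of_mem ht]
      rw [norm_ofReal_cpow_mul_exp ht, Complex.one_re]
    · simp only [hf, indicator_of_notMem ht, norm_zero, le_refl]
  have hFi : Integrable (FourierTransform.fourier f) := by
    rw [funext hfourier]
    refine Integrable.mul_const ?_ _
    refine (integrable_norm_verticalLine_rpow hz).mono'
      (continuous_verticalLine_cpow _).aestronglyMeasurable (Eventually.of_forall fun w => ?_)
    rw [← Complex.ofReal_neg, Complex.norm_cpow_real]
  have hcont : ContinuousAt f 1 := by
    have : ContinuousAt (fun t : ℝ => (t : ℂ) ^ ((z : ℂ) - 1) * Complex.exp (-(1 * t))) 1 :=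
      (Complex.continuousAt_ofReal_cpow_const _ _ (Or.inr one_ne_zero)).mul (by fun_prop)
    refine this.congr ?_
    filter_upwards [Ioi_mem_nhds (one_pos : (0 : ℝ) < 1)] with t ht
    rw [hf, indicator_of_mem ht]
  have hinv := hfi.fourierInv_fourier_eq hFi hcont
  rw [Real.fourierInv_eq', hf, indicator_of_mem (by simp : (1 : ℝ) ∈ Ioi (0 : ℝ))] at hinv
  rw [← hf] at hinv
  simp only [hfourier, smul_eq_mul, Complex.ofReal_one, Complex.one_cpow, one_mul, mul_one] at hinv
  have hexp : ∀ w : ℝ, Complex.exp (verticalLine w) * verticalLine w ^ (-(z : ℂ)) =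
      (Complex.exp 1 * (Complex.Gamma z)⁻¹) *
        (Complex.exp (((2 * π * inner ℝ w 1 : ℝ) : ℂ) * Complex.I) *
          (verticalLine w ^ (-(z : ℂ)) * Complex.Gamma z)) := by
    intro w
    have : Complex.exp (verticalLine w) =
        Complex.exp 1 * Complex.exp (((2 * π * inner ℝ w 1 : ℝ) : ℂ) * Complex.I) := by
      rw [← Complex.exp_add]
      simp [verticalLine]
    rw [this]
    field_simp
  simp only [hexp]
  rw [integral_const_mul, hinv, mul_right_comm, ← Complex.exp_add]
  simp

theorem one_le_norm_verticalLine_cpow {α : ℝ} (hα : 0 ≤ α) (w : ℝ) :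
    1 ≤ ‖verticalLine w ^ (α : ℂ)‖ := by
  rw [Complex.norm_cpow_real]
  exact Real.one_le_rpow (one_le_norm_verticalLine w) hα

theorem cos_mul_norm_le_re_verticalLine_cpow {α : ℝ} (hα : α ∈ Ioo (0 : ℝ) 1) (w : ℝ) :
    Real.cos (π / 2 * α) * ‖verticalLine w ^ (α : ℂ)‖ ≤ (verticalLine w ^ (α : ℂ)).re := by
  have harg : |(verticalLine w).arg| ≤ π / 2 :=
    Complex.abs_arg_le_pi_div_two_iff.2 (by rw [verticalLine_re]; exact zero_le_one)
  rw [Complex.cpow_ofReal_re, Complex.norm_cpow_real, mul_comm]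
  refine mul_le_mul_of_nonneg_left ?_ (by positivity)
  rw [← Real.cos_abs ((verticalLine w).arg * α), abs_mul, abs_of_pos hα.1]
  have hα0 := hα.1
  refine Real.cos_le_cos_of_nonneg_of_le_pi (by positivity) ?_ (by gcongr)
  nlinarith [Real.pi_pos, hα.2]

theorem cos_pi_div_two_mul_pos {α : ℝ} (hα : α ∈ Ioo (0 : ℝ) 1) : 0 < Real.cos (π / 2 * α) := by
  have h0 := hα.1
  refine Real.cos_pos_of_mem_Ioo ⟨?_, ?_⟩ <;> nlinarith [Real.pi_pos, hα.2, mul_pos Real.pi_pos h0]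

theorem cos_div_two_mul_norm_le_norm_add {α : ℝ} (hα : α ∈ Ioo (0 : ℝ) 1) {x : ℂ}
    (hx : -(Real.cos (π / 2 * α) / 2) < x.re) (w : ℝ) :
    Real.cos (π / 2 * α) / 2 * ‖verticalLine w ^ (α : ℂ)‖ ≤ ‖verticalLine w ^ (α : ℂ) + x‖ := by
  have h1 := cos_mul_norm_le_re_verticalLine_cpow hα w
  have h2 := one_le_norm_verticalLine_cpow hα.1.le w
  have h3 := Complex.re_le_norm (verticalLine w ^ (α : ℂ) + x)
  rw [Complex.add_re] at h3
  nlinarith [cos_pi_div_two_mul_pos hα]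

theorem verticalLine_cpow_add_ne_zero {α : ℝ} (hα : α ∈ Ioo (0 : ℝ) 1) {x : ℂ}
    (hx : -(Real.cos (π / 2 * α) / 2) < x.re) (w : ℝ) : verticalLine w ^ (α : ℂ) + x ≠ 0 := by
  have h1 := cos_div_two_mul_norm_le_norm_add hα hx w
  have h2 := one_le_norm_verticalLine_cpow hα.1.le w
  have h3 := cos_pi_div_two_mul_pos hα
  exact norm_pos_iff.1 (lt_of_lt_of_le (by positivity) h1)

/-- The integrand, on the line `Re s = 1`, of the absolutely convergent inverse Laplace integral
representing `E_{α,1}(-x)`. -/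
noncomputable def mittagLefflerIntegrand (α : ℝ) (x : ℂ) (w : ℝ) : ℂ :=
  Complex.exp (verticalLine w) * verticalLine w ^ (-(2 : ℂ)) *
    ((1 - α) * (verticalLine w ^ (α : ℂ) / (verticalLine w ^ (α : ℂ) + x)) +
      α * (verticalLine w ^ (α : ℂ) / (verticalLine w ^ (α : ℂ) + x)) ^ 2)

theorem norm_exp_verticalLine (w : ℝ) : ‖Complex.exp (verticalLine w)‖ = Real.exp 1 := by
  rw [Complex.norm_exp, verticalLine_re]

theorem norm_verticalLine_cpow_neg_two (w : ℝ) :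
    ‖verticalLine w ^ (-(2 : ℂ))‖ = ‖verticalLine w‖ ^ (-2 : ℝ) := by
  have := Complex.norm_cpow_real (verticalLine w) (-2)
  simpa using this

theorem continuous_mittagLefflerIntegrand {α : ℝ} (hα : α ∈ Ioo (0 : ℝ) 1) {x : ℂ}
    (hx : -(Real.cos (π / 2 * α) / 2) < x.re) : Continuous (mittagLefflerIntegrand α x) := by
  have h : Continuous fun w => verticalLine w ^ (α : ℂ) / (verticalLine w ^ (α : ℂ) + x) :=
    (continuous_verticalLine_cpow _).div ((continuous_verticalLine_cpow _).add continuous_const)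
      (verticalLine_cpow_add_ne_zero hα hx)
  have h2 := continuous_verticalLine_cpow (-(2 : ℂ))
  unfold mittagLefflerIntegrand
  fun_prop

theorem differentiableOn_integral_mittagLefflerIntegrand {α : ℝ} (hα : α ∈ Ioo (0 : ℝ) 1) :
    DifferentiableOn ℂ (fun x => ∫ w, mittagLefflerIntegrand α x w)
      {x | -(Real.cos (π / 2 * α) / 2) < x.re} := by
  set δ := Real.cos (π / 2 * α) / 2 with hδ
  have hδ0 : 0 < δ := half_pos (cos_pi_div_two_mul_pos hα)
  refine differentiableOn_integral_of_norm_le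
    (isOpen_lt continuous_const Complex.continuous_re)
    (bound := fun w => Real.exp 1 * ‖verticalLine w‖ ^ (-2 : ℝ) * ((1 - α) * δ⁻¹ + α * δ⁻¹ ^ 2))
    (fun x hx => (continuous_mittagLefflerIntegrand hα hx).aestronglyMeasurable) (fun w => ?_)
    (((integrable_norm_verticalLine_rpow one_lt_two).const_mul _).mul_const _)
    (fun x hx w => ?_)
  · have h : DifferentiableOn ℂ
        (fun x => verticalLine w ^ (α : ℂ) / (verticalLine w ^ (α : ℂ) + x)) {x | -δ < x.re} :=
      (differentiableOn_const _).div ((differentiableOn_const _).add differentiableOn_id)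
        fun x hx => verticalLine_cpow_add_ne_zero hα hx w
    unfold mittagLefflerIntegrand
    fun_prop
  · have hq : ‖verticalLine w ^ (α : ℂ) / (verticalLine w ^ (α : ℂ) + x)‖ ≤ δ⁻¹ := by
      rw [norm_div, div_le_iff₀ (norm_pos_iff.2 (verticalLine_cpow_add_ne_zero hα hx w)),
        inv_mul_eq_div, le_div_iff₀' hδ0]
      exact cos_div_two_mul_norm_le_norm_add hα hx w
    rw [mittagLefflerIntegrand, norm_mul, norm_mul, norm_exp_verticalLine,
      norm_verticalLine_cpow_neg_two]
    have h1 : ‖(1 - α : ℂ)‖ = 1 - α := by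
      rw [← Complex.ofReal_one, ← Complex.ofReal_sub, Complex.norm_real,
        Real.norm_of_nonneg (by linarith [hα.2])]
    have h2 : ‖(α : ℂ)‖ = α := by rw [Complex.norm_real, Real.norm_of_nonneg hα.1.le]
    have h3 : 0 ≤ 1 - α := by linarith [hα.2]
    have h4 := hα.1.le
    refine mul_le_mul_of_nonneg_left ((norm_add_le _ _).trans ?_) (by positivity)
    rw [norm_mul, norm_mul, norm_pow, h1, h2]
    gcongr

theorem rpow_mul_exp_neg_le_Gamma {M z : ℝ} (hM : 0 < M) (hz : 1 ≤ z) :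
    M ^ (z - 1) * Real.exp (-(M + 1)) ≤ Real.Gamma z := by
  rw [Real.Gamma_eq_integral (by linarith)]
  have hint := Real.GammaIntegral_convergent (by linarith : 0 < z)
  have hsub : Ioc M (M + 1) ⊆ Ioi (0 : ℝ) := fun t ht => hM.trans ht.1
  calc M ^ (z - 1) * Real.exp (-(M + 1))
      = ∫ _ in Ioc M (M + 1), M ^ (z - 1) * Real.exp (-(M + 1)) := by simp
    _ ≤ ∫ t in Ioc M (M + 1), Real.exp (-t) * t ^ (z - 1) := by
        refine setIntegral_mono_on (integrableOn_const (by simp)) (hint.mono_set hsub) measurableSet_Ioc fun t ht => ?_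
        rw [mul_comm]
        have h1 := ht.1.le
        have h2 := ht.2
        have h3 : 0 ≤ z - 1 := by linarith
        gcongr
    _ ≤ ∫ t in Ioi (0 : ℝ), Real.exp (-t) * t ^ (z - 1) := by
        refine setIntegral_mono_set hint ?_ (Eventually.of_forall hsub)
        filter_upwards [ae_restrict_mem measurableSet_Ioi] with t ht
        have : (0 : ℝ) < t := ht
        simp only [Pi.zero_apply]
        positivity

theorem summable_pow_div_Gamma {α R : ℝ} (hα : 0 < α) (hR : 0 < R) :
    Summable fun k : ℕ => R ^ k / Real.Gamma ((k : ℝ) * α + 1) := by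
  set M := (2 * R) ^ (1 / α) with hM
  have hM0 : 0 < M := by positivity
  have hMα : M ^ α = 2 * R := by
    rw [hM, ← Real.rpow_mul (by positivity), one_div_mul_cancel hα.ne', Real.rpow_one]
  refine Summable.of_nonneg_of_le (fun k => ?_) (fun k => ?_)
    ((summable_geometric_two).mul_left (Real.exp (M + 1)))
  · have := Real.Gamma_pos_of_pos (by positivity : 0 < (k : ℝ) * α + 1)
    positivity
  · have hΓ := rpow_mul_exp_neg_le_Gamma hM0 (z := (k : ℝ) * α + 1) (by
      have : 0 ≤ (k : ℝ) * α := by positivity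
      linarith)
    rw [add_sub_cancel_right, mul_comm (k : ℝ) α, Real.rpow_mul hM0.le, hMα, Real.rpow_natCast,
      mul_comm α] at hΓ
    refine (div_le_div_of_nonneg_left (by positivity) (by positivity) hΓ).trans (le_of_eq ?_)
    rw [Real.exp_neg, mul_pow, div_pow, one_pow]
    field_simp

theorem differentiable_mlC {α : ℝ} (hα : 0 < α) : Differentiable ℂ (mlC α 1) := by
  intro z
  have hz : z ∈ Metric.ball (0 : ℂ) (‖z‖ + 1) := by simp
  have hd : DifferentiableOn ℂ (mlC α 1) (Metric.ball 0 (‖z‖ + 1)) := by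
    unfold mlC
    refine Complex.differentiableOn_tsum_of_summable_norm
      (summable_pow_div_Gamma hα (by positivity : 0 < ‖z‖ + 1)) (fun k => by fun_prop)
      Metric.isOpen_ball fun k w hw => ?_
    have hΓ := Real.Gamma_pos_of_pos (by positivity : 0 < (k : ℝ) * α + 1)
    rw [Complex.Gamma_ofReal, norm_div, norm_pow, Complex.norm_real, Real.norm_of_nonneg hΓ.le]
    have : ‖w‖ ≤ ‖z‖ + 1 := by simpa using (Metric.mem_ball.1 hw).le
    gcongr
  exact hd.differentiableAt (Metric.isOpen_ball.mem_nhds hz)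

theorem mlC_ofReal (a b x : ℝ) : mlC a b x = mlR a b x := by
  simp only [mlC, mlR, Complex.ofReal_tsum]
  refine tsum_congr fun k => ?_
  rw [Complex.Gamma_ofReal]
  push_cast
  rfl

theorem hasSum_mittagLefflerIntegrand {α : ℝ} (hα : α ∈ Ioo (0 : ℝ) 1) {x : ℂ} (hx : ‖x‖ < 1)
    (w : ℝ) :
    HasSum (fun k : ℕ => (-x) ^ k * (1 + α * k) *
      (Complex.exp (verticalLine w) * verticalLine w ^ (-((2 + α * k : ℝ) : ℂ))))
      (mittagLefflerIntegrand α x w) := by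
  set A := verticalLine w ^ (α : ℂ) with hA
  have hA1 : 1 ≤ ‖A‖ := one_le_norm_verticalLine_cpow hα.1.le w
  have hA0 : A ≠ 0 := norm_pos_iff.1 (by linarith)
  have hAx : A + x ≠ 0 := by
    intro h
    rw [eq_neg_of_add_eq_zero_left h, norm_neg] at hA1
    linarith
  have hq : ‖-x / A‖ < 1 := by
    rw [norm_div, norm_neg, div_lt_one (by linarith)]
    linarith
  have h := ((hasSum_geometric_of_norm_lt_one hq).add
    ((hasSum_coe_mul_geometric_of_norm_lt_one hq).mul_left (α : ℂ))).mul_left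
      (Complex.exp (verticalLine w) * verticalLine w ^ (-(2 : ℂ)))
  have hval : mittagLefflerIntegrand α x w = Complex.exp (verticalLine w) *
      verticalLine w ^ (-(2 : ℂ)) * ((1 - -x / A)⁻¹ + α * (-x / A / (1 - -x / A) ^ 2)) := by
    have h1 : 1 - -x / A = (A + x) / A := by field_simp; ring
    rw [h1, mittagLefflerIntegrand, ← hA]
    congr 1
    field_simp
    ring
  rw [hval]
  refine Eq.mpr (congrArg (HasSum · _ _) (funext fun k => ?_)) h
  have : verticalLine w ^ (-((2 + α * k : ℝ) : ℂ)) =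
      verticalLine w ^ (-(2 : ℂ)) * (A⁻¹) ^ k := by
    rw [hA, ← Complex.cpow_neg, ← Complex.cpow_nat_mul,
      ← Complex.cpow_add _ _ (verticalLine_ne_zero w)]
    congr 1
    push_cast
    ring
  rw [this, div_eq_mul_inv, mul_pow]
  ring

theorem mlC_neg_eq_integral_of_norm_lt_one {α : ℝ} (hα : α ∈ Ioo (0 : ℝ) 1) {x : ℂ}
    (hx : ‖x‖ < 1) : mlC α 1 (-x) = ∫ w, mittagLefflerIntegrand α x w := by
  have hαk : ∀ k : ℕ, 0 ≤ α * k := fun k => mul_nonneg hα.1.le (Nat.cast_nonneg k)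
  have hmeas : ∀ k : ℕ, Continuous fun w =>
      Complex.exp (verticalLine w) * verticalLine w ^ (-((2 + α * k : ℝ) : ℂ)) := fun k =>
    (Complex.continuous_exp.comp continuous_verticalLine).mul (continuous_verticalLine_cpow _)
  have hbound : ∀ (k : ℕ) w, ‖Complex.exp (verticalLine w) *
      verticalLine w ^ (-((2 + α * k : ℝ) : ℂ))‖ ≤ Real.exp 1 * ‖verticalLine w‖ ^ (-2 : ℝ) := by
    intro k w
    rw [norm_mul, norm_exp_verticalLine, ← Complex.ofReal_neg, Complex.norm_cpow_real]
    gcongr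
    · exact one_le_norm_verticalLine w
    · linarith [hαk k]
  have hdom : Integrable fun w => Real.exp 1 * ‖verticalLine w‖ ^ (-2 : ℝ) :=
    (integrable_norm_verticalLine_rpow one_lt_two).const_mul _
  have hint : ∀ k : ℕ, Integrable fun w =>
      Complex.exp (verticalLine w) * verticalLine w ^ (-((2 + α * k : ℝ) : ℂ)) := fun k =>
    hdom.mono' (hmeas k).aestronglyMeasurable (Eventually.of_forall (hbound k))
  have hcoef : ∀ k : ℕ, ‖(-x) ^ k * (1 + α * k)‖ = ‖x‖ ^ k * (1 + α * k) := by
    intro k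
    have : (1 + α * k : ℂ) = ((1 + α * k : ℝ) : ℂ) := by push_cast; rfl
    rw [norm_mul, norm_pow, norm_neg, this, Complex.norm_real,
      Real.norm_of_nonneg (by linarith [hαk k])]
  have hsum : Summable fun k : ℕ => ‖x‖ ^ k * (1 + α * k) := by
    have hx' : ‖‖x‖‖ < 1 := by rwa [norm_norm]
    refine ((summable_geometric_of_norm_lt_one hx').add
      ((hasSum_coe_mul_geometric_of_norm_lt_one hx').summable.mul_left α)).congr fun k => ?_
    ring
  have h := hasSum_integral_of_summable_integral_norm (μ := volume)
    (F := fun (k : ℕ) w => (-x) ^ k * (1 + α * k) *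
      (Complex.exp (verticalLine w) * verticalLine w ^ (-((2 + α * k : ℝ) : ℂ))))
    (fun k => (hint k).const_mul _) (by
      refine Summable.of_nonneg_of_le (fun k => integral_nonneg fun w => norm_nonneg _)
        (fun k => ?_) (hsum.mul_right (∫ w, Real.exp 1 * ‖verticalLine w‖ ^ (-2 : ℝ)))
      simp only [norm_mul _ (Complex.exp _ * _), hcoef]
      rw [integral_const_mul]
      refine mul_le_mul_of_nonneg_left (integral_mono (hint k).norm hdom (hbound k)) ?_
      have := hαk k
      positivity)
  simp only [fun w => (hasSum_mittagLefflerIntegrand hα hx w).tsum_eq] at h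
  rw [← h.tsum_eq, mlC]
  refine tsum_congr fun k => ?_
  rw [integral_const_mul, integral_exp_mul_verticalLine_cpow (by linarith [hαk k])]
  have h1 : (0 : ℝ) < k * α + 1 := by linarith [hαk k]
  have h2 : (2 + α * k : ℝ) = (k * α + 1) + 1 := by ring
  have hΓ := (Real.Gamma_pos_of_pos h1).ne'
  rw [h2, Complex.Gamma_ofReal, Complex.Gamma_ofReal, Real.Gamma_add_one h1.ne']
  have h3 : (1 + α * k : ℂ) = ((k * α + 1 : ℝ) : ℂ) := by push_cast; ring
  have h4 : ((k * α + 1 : ℝ) : ℂ) ≠ 0 := Complex.ofReal_ne_zero.2 h1.ne'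
  have h5 : ((Real.Gamma (k * α + 1) : ℝ) : ℂ) ≠ 0 := Complex.ofReal_ne_zero.2 hΓ
  rw [h3, Complex.ofReal_mul]
  field_simp

theorem mlC_neg_eq_integral {α : ℝ} (hα : α ∈ Ioo (0 : ℝ) 1) {x : ℂ}
    (hx : -(Real.cos (π / 2 * α) / 2) < x.re) :
    mlC α 1 (-x) = ∫ w, mittagLefflerIntegrand α x w := by
  have hU : IsOpen {x : ℂ | -(Real.cos (π / 2 * α) / 2) < x.re} :=
    isOpen_lt continuous_const Complex.continuous_re
  have hml : DifferentiableOn ℂ (fun x => mlC α 1 (-x))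
      {x : ℂ | -(Real.cos (π / 2 * α) / 2) < x.re} :=
    ((differentiable_mlC hα.1).comp differentiable_neg).differentiableOn
  refine (hml.analyticOnNhd hU).eqOn_of_preconnected_of_eventuallyEq
    ((differentiableOn_integral_mittagLefflerIntegrand hα).analyticOnNhd hU)
    (convex_halfSpace_re_gt _).isPreconnected (z₀ := 0) ?_ ?_ hx
  · simpa using cos_pi_div_two_mul_pos hα
  · filter_upwards [Metric.ball_mem_nhds (0 : ℂ) one_pos] with y hy
    exact mlC_neg_eq_integral_of_norm_lt_one hα (by simpa using hy)

theorem mul_mittagLefflerIntegrand {α : ℝ} (t : ℂ) (w : ℝ) :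
    t * mittagLefflerIntegrand α t w =
      Complex.exp (verticalLine w) * verticalLine w ^ (-((2 - α : ℝ) : ℂ)) *
      ((1 - α) * (t / (verticalLine w ^ (α : ℂ) + t)) +
        α * (verticalLine w ^ (α : ℂ) / (verticalLine w ^ (α : ℂ) + t)) *
          (t / (verticalLine w ^ (α : ℂ) + t))) := by
  have : verticalLine w ^ (-((2 - α : ℝ) : ℂ)) =
      verticalLine w ^ (-(2 : ℂ)) * verticalLine w ^ (α : ℂ) := by
    rw [← Complex.cpow_add _ _ (verticalLine_ne_zero w)]
    congr 1
    push_cast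
    ring
  rw [this, mittagLefflerIntegrand]
  ring

theorem tendsto_mul_integral_mittagLefflerIntegrand {α : ℝ} (hα : α ∈ Ioo (0 : ℝ) 1) :
    Tendsto (fun t : ℝ => (t : ℂ) * ∫ w, mittagLefflerIntegrand α t w) atTop
      (𝓝 ((1 / Real.Gamma (1 - α) : ℝ) : ℂ)) := by
  have hlim : ∫ w, (1 - α : ℂ) * (Complex.exp (verticalLine w) *
      verticalLine w ^ (-((2 - α : ℝ) : ℂ))) = ((1 / Real.Gamma (1 - α) : ℝ) : ℂ) := by
    have h1 : 0 < 1 - α := by linarith [hα.2]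
    have h2 : 2 - α = (1 - α) + 1 := by ring
    rw [integral_const_mul, integral_exp_mul_verticalLine_cpow (by linarith), h2,
      Complex.Gamma_ofReal, Real.Gamma_add_one h1.ne']
    have h3 : (1 - α : ℂ) = ((1 - α : ℝ) : ℂ) := by push_cast; rfl
    rw [h3, ← Complex.ofReal_inv, ← Complex.ofReal_mul]
    congr 1
    field_simp
  have hre : ∀ {t : ℝ}, 0 < t → -(Real.cos (π / 2 * α) / 2) < (t : ℂ).re := fun ht => by
    rw [Complex.ofReal_re]
    linarith [cos_pi_div_two_mul_pos hα]
  rw [← hlim]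
  simp only [← integral_const_mul _ (mittagLefflerIntegrand _ _)]
  refine tendsto_integral_filter_of_dominated_convergence
    (fun w => Real.exp 1 * ‖verticalLine w‖ ^ (-(2 - α))) ?_ ?_
    ((integrable_norm_verticalLine_rpow (by linarith [hα.2])).const_mul _) ?_
  · filter_upwards [eventually_gt_atTop 0] with t ht
    exact ((continuous_mittagLefflerIntegrand hα (hre ht)).aestronglyMeasurable).const_mul _
  · filter_upwards [eventually_gt_atTop 0] with t ht
    refine Eventually.of_forall fun w => ?_
    set A := verticalLine w ^ (α : ℂ) with hA
    have hAre : 0 ≤ A.re := le_trans (mul_nonneg (cos_pi_div_two_mul_pos hα).le (norm_nonneg _))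
      (cos_mul_norm_le_re_verticalLine_cpow hα w)
    have hAt : 0 < ‖A + t‖ := norm_pos_iff.2 (verticalLine_cpow_add_ne_zero hα (hre ht) w)
    have h1 : ‖(t : ℂ) / (A + t)‖ ≤ 1 := by
      rw [norm_div, div_le_one hAt, Complex.norm_real, Real.norm_of_nonneg ht.le]
      have := Complex.re_le_norm (A + t)
      rw [Complex.add_re, Complex.ofReal_re] at this
      linarith
    have h2 : ‖A / (A + t)‖ ≤ 1 := by
      rw [norm_div, div_le_one hAt]
      refine (sq_le_sq₀ (norm_nonneg _) hAt.le).1 ?_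
      rw [← Complex.normSq_eq_norm_sq, ← Complex.normSq_eq_norm_sq, Complex.normSq_apply,
        Complex.normSq_apply]
      simp only [Complex.add_re, Complex.ofReal_re, Complex.add_im, Complex.ofReal_im, add_zero]
      nlinarith
    have h3 : ‖(1 - α : ℂ)‖ = 1 - α := by
      rw [← Complex.ofReal_one, ← Complex.ofReal_sub, Complex.norm_real,
        Real.norm_of_nonneg (by linarith [hα.2])]
    have h4 : ‖(α : ℂ)‖ = α := by rw [Complex.norm_real, Real.norm_of_nonneg hα.1.le]
    have h5 : 0 ≤ 1 - α := by linarith [hα.2]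
    have h6 := hα.1.le
    rw [mul_mittagLefflerIntegrand, norm_mul, norm_mul, norm_exp_verticalLine,
      ← Complex.ofReal_neg, Complex.norm_cpow_real, ← hA]
    refine mul_le_of_le_one_right (by positivity) ((norm_add_le _ _).trans ?_)
    rw [norm_mul, norm_mul, norm_mul, h3, h4]
    calc (1 - α) * ‖(t : ℂ) / (A + t)‖ + α * ‖A / (A + t)‖ * ‖(t : ℂ) / (A + t)‖
        ≤ (1 - α) * 1 + α * 1 * 1 := by gcongr
      _ = 1 := by ring
  · refine Eventually.of_forall fun w => ?_
    set A := verticalLine w ^ (α : ℂ) with hA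
    have hinf : Tendsto (fun t : ℝ => A + (t : ℂ)) atTop (Bornology.cobounded ℂ) := by
      refine tendsto_norm_atTop_iff_cobounded.1
        (tendsto_atTop_mono (fun t => Complex.re_le_norm _) ?_)
      simp only [Complex.add_re, Complex.ofReal_re]
      exact tendsto_atTop_add_const_left _ _ tendsto_id
    have h0 : Tendsto (fun t : ℝ => A / (A + (t : ℂ))) atTop (𝓝 0) := by
      simpa [div_eq_mul_inv] using (tendsto_inv₀_cobounded.comp hinf).const_mul A
    have h1 : Tendsto (fun t : ℝ => (t : ℂ) / (A + (t : ℂ))) atTop (𝓝 1) := by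
      have := (tendsto_const_nhds (x := (1 : ℂ))).sub h0
      rw [sub_zero] at this
      refine this.congr' ?_
      filter_upwards [eventually_gt_atTop 0] with t ht
      have := verticalLine_cpow_add_ne_zero hα (hre ht) w
      rw [← hA] at this
      field_simp
      ring
    simp only [mul_mittagLefflerIntegrand, ← hA]
    have := ((h1.const_mul (1 - α : ℂ)).add ((h0.const_mul (α : ℂ)).mul h1)).const_mul
      (Complex.exp (verticalLine w) * verticalLine w ^ (-((2 - α : ℝ) : ℂ)))
    convert this using 2
    ring

/-- Linear decay of `E_{α,1}` on the negative real axis. -/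
theorem stmt_3 (α : ℝ) (hα : α ∈ Set.Ioo (0:ℝ) 1) :
    Filter.Tendsto (fun t : ℝ => t * mlR α 1 (-t)) Filter.atTop
      (nhds (1 / Real.Gamma (1 - α))) := by
  have h := (Complex.continuous_re.tendsto _).comp
    (tendsto_mul_integral_mittagLefflerIntegrand hα)
  rw [Complex.ofReal_re] at h
  refine h.congr' ?_
  filter_upwards [eventually_gt_atTop 0] with t ht
  rw [Function.comp_apply, ← mlC_neg_eq_integral hα, ← Complex.ofReal_neg, mlC_ofReal,
    ← Complex.ofReal_mul, Complex.ofReal_re]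
  rw [Complex.ofReal_re]
  linarith [cos_pi_div_two_mul_pos hα]
end

section
/- Let α ∈ (0,1) and λ ∈ ℝ. Then the function u(t) = E_{α,1}(−λ t^α) satisfies u(0) = 1 and the fractional ordinary differential equation (∂_t^α u)(t) = −λ u(t) for all t > 0, where ∂_t^α is the Djrbashian–Caputo fractional derivative of order α. -/
open scoped Real

open Filter Topology MeasureTheory Set

/-- Log-convexity estimate `Γ(x + 1) ≤ Γ(x + a) (x + a) ^ (1 - a)` for the ratio of Gamma values. -/
theorem Gamma_add_one_le_Gamma_add_mul_rpow {a x : ℝ} (ha0 : 0 < a) (ha1 : a < 1) (hx : 0 < x) :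
    Real.Gamma (x + 1) ≤ Real.Gamma (x + a) * (x + a) ^ (1 - a) := by
  have hxa : 0 < x + a := by positivity
  have hG : 0 < Real.Gamma (x + a) := Real.Gamma_pos_of_pos hxa
  have h := Real.Gamma_mul_add_mul_le_rpow_Gamma_mul_rpow_Gamma hxa
    (add_pos hxa one_pos) ha0 (sub_pos.2 ha1) (by ring)
  calc Real.Gamma (x + 1)
      = Real.Gamma (a * (x + a) + (1 - a) * (x + a + 1)) := by ring_nf
    _ ≤ _ := h
    _ = Real.Gamma (x + a) * (x + a) ^ (1 - a) := by
      rw [Real.Gamma_add_one hxa.ne', Real.mul_rpow hxa.le hG.le, mul_left_comm,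
        ← Real.rpow_add hG]
      simp [mul_comm]

theorem tendsto_Gamma_div_Gamma_add {a : ℝ} (ha0 : 0 < a) (ha1 : a < 1) :
    Tendsto (fun x : ℝ => Real.Gamma x / Real.Gamma (x + a)) atTop (𝓝 0) := by
  have hlim : Tendsto (fun x : ℝ => 2 * (x + a) ^ (-a)) atTop (𝓝 0) := by
    simpa using ((tendsto_rpow_neg_atTop ha0).comp
      (tendsto_atTop_add_const_right atTop a tendsto_id)).const_mul 2
  refine squeeze_zero' ?_ ?_ hlim
  · filter_upwards [eventually_gt_atTop 0] with x hx
    exact div_nonneg (Real.Gamma_pos_of_pos hx).le (Real.Gamma_pos_of_pos (by positivity)).le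
  · filter_upwards [eventually_ge_atTop a] with x hx
    have hx0 : 0 < x := ha0.trans_le hx
    have hxa : 0 < x + a := by positivity
    have hG : 0 < Real.Gamma (x + a) := Real.Gamma_pos_of_pos hxa
    have h := Gamma_add_one_le_Gamma_add_mul_rpow ha0 ha1 hx0
    rw [Real.Gamma_add_one hx0.ne', sub_eq_add_neg, Real.rpow_add hxa, Real.rpow_one] at h
    have hp : 0 < (x + a) ^ (-a) := Real.rpow_pos_of_pos hxa _
    rw [div_le_iff₀ hG]
    refine le_of_mul_le_mul_left (h.trans ?_) hx0
    have : x + a ≤ 2 * x := by linarith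
    calc Real.Gamma (x + a) * ((x + a) * (x + a) ^ (-a))
        ≤ Real.Gamma (x + a) * (2 * x * (x + a) ^ (-a)) := by gcongr
      _ = _ := by ring

theorem summable_pow_div_Gamma_s6 {a b : ℝ} (ha0 : 0 < a) (ha1 : a < 1) (hb : 0 < b) (x : ℝ) :
    Summable fun k : ℕ => x ^ k / Real.Gamma ((k : ℝ) * a + b) := by
  rcases eq_or_ne x 0 with rfl | hx
  · refine summable_of_ne_finset_zero (s := {0}) fun k hk => ?_
    rw [zero_pow (by simpa using hk), zero_div]
  have hG (k : ℕ) : 0 < Real.Gamma ((k : ℝ) * a + b) := Real.Gamma_pos_of_pos (by positivity)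
  refine summable_of_ratio_test_tendsto_lt_one zero_lt_one
    (Eventually.of_forall fun k => div_ne_zero (pow_ne_zero _ hx) (hG k).ne') ?_
  have hk : Tendsto (fun k : ℕ => (k : ℝ) * a + b) atTop atTop :=
    tendsto_atTop_add_const_right _ _ (tendsto_natCast_atTop_atTop.atTop_mul_const ha0)
  have h := ((tendsto_Gamma_div_Gamma_add ha0 ha1).comp hk).const_mul |x|
  rw [mul_zero] at h
  refine h.congr fun k => ?_
  have h1 := hG k
  have h2 := hG (k + 1)
  have hx' : |x| ≠ 0 := abs_ne_zero.2 hx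
  have he : ((k + 1 : ℕ) : ℝ) * a + b = (k : ℝ) * a + b + a := by push_cast; ring
  rw [he] at h2 ⊢
  simp only [Function.comp_apply, norm_div, norm_pow, Real.norm_eq_abs, abs_of_pos h1,
    abs_of_pos h2, pow_succ, abs_mul, abs_pow]
  field_simp

theorem integral_rpow_mul_sub_rpow {u v a : ℝ} (hu : 0 < u) (hv : 0 < v) (ha : 0 < a) :
    ∫ x in (0:ℝ)..a, x ^ (u - 1) * (a - x) ^ (v - 1) =
      a ^ (u + v - 1) * (Real.Gamma u * Real.Gamma v / Real.Gamma (u + v)) := by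
  have h := Complex.betaIntegral_scaled (u : ℂ) (v : ℂ) ha
  rw [Complex.betaIntegral_eq_Gamma_mul_div _ _ (by simpa) (by simpa)] at h
  have hc : ∫ x in (0:ℝ)..a, (x : ℂ) ^ ((u : ℂ) - 1) * ((a : ℂ) - x) ^ ((v : ℂ) - 1) =
      ∫ x in (0:ℝ)..a, ((x ^ (u - 1) * (a - x) ^ (v - 1) : ℝ) : ℂ) := by
    refine intervalIntegral.integral_congr fun x hx => ?_
    rw [uIcc_of_le ha.le] at hx
    rw [Complex.ofReal_mul, Complex.ofReal_cpow hx.1, Complex.ofReal_cpow (sub_nonneg.2 hx.2)]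
    push_cast
    rfl
  rw [hc, intervalIntegral.integral_ofReal] at h
  apply Complex.ofReal_injective
  rw [h]
  push_cast [Complex.ofReal_cpow ha.le, ← Complex.Gamma_ofReal]
  rfl

theorem mlR_one_eq_one_add_tsum {a : ℝ} (ha0 : 0 < a) (ha1 : a < 1) (x : ℝ) :
    mlR a 1 x = 1 + ∑' k : ℕ, x ^ (k + 1) / Real.Gamma ((k : ℝ) * a + a + 1) := by
  rw [mlR, (summable_pow_div_Gamma_s6 ha0 ha1 one_pos x).tsum_eq_zero_add]
  simp [add_mul]

theorem hasDerivAt_mlR_neg_mul_rpow {a : ℝ} (ha0 : 0 < a) (ha1 : a < 1) (c : ℝ) {s : ℝ}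
    (hs : 0 < s) :
    HasDerivAt (fun y => mlR a 1 (-(c * y ^ a)))
      (∑' k : ℕ, (-c) ^ (k + 1) / Real.Gamma ((k : ℝ) * a + a) * s ^ ((k : ℝ) * a + a - 1)) s := by
  have hpow {y : ℝ} (hy : 0 < y) (k : ℕ) : (y ^ a) ^ (k + 1) = y ^ ((k : ℝ) * a + a) := by
    rw [← Real.rpow_natCast, ← Real.rpow_mul hy.le]
    congr 1; push_cast; ring
  have hpos (k : ℕ) : 0 < (k : ℝ) * a + a := by positivity
  have hterm {y : ℝ} (hy : 0 < y) (k : ℕ) :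
      (-(c * y ^ a)) ^ (k + 1) / Real.Gamma ((k : ℝ) * a + a + 1) =
        (-c) ^ (k + 1) / Real.Gamma ((k : ℝ) * a + a + 1) * y ^ ((k : ℝ) * a + a) := by
    rw [← neg_mul, mul_pow, hpow hy]
    ring
  have hmem : s ∈ Ioo (s / 2) (2 * s) := ⟨by linarith, by linarith⟩
  have hbound : Summable fun k : ℕ =>
      (|c| * (2 * s) ^ a) ^ k / Real.Gamma ((k : ℝ) * a + a) *
        (|c| * (2 * s) ^ a / (s / 2)) :=
    (summable_pow_div_Gamma_s6 ha0 ha1 ha0 _).mul_right _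
  have hsum : Summable fun k : ℕ =>
      (-c) ^ (k + 1) / Real.Gamma ((k : ℝ) * a + a + 1) * s ^ ((k : ℝ) * a + a) := by
    refine ((summable_nat_add_iff 1).2
      (summable_pow_div_Gamma_s6 ha0 ha1 one_pos (-(c * s ^ a)))).congr fun k => ?_
    rw [← hterm hs k]
    push_cast
    rw [add_mul, one_mul]
  have key := hasDerivAt_tsum_of_isPreconnected hbound isOpen_Ioo isPreconnected_Ioo
    (g := fun (k : ℕ) (y : ℝ) =>
      (-c) ^ (k + 1) / Real.Gamma ((k : ℝ) * a + a + 1) * y ^ ((k : ℝ) * a + a))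
    (g' := fun (k : ℕ) (y : ℝ) =>
      (-c) ^ (k + 1) / Real.Gamma ((k : ℝ) * a + a) * y ^ ((k : ℝ) * a + a - 1))
    (fun k y hy => ?_) (fun k y hy => ?_) hmem hsum hmem
  · refine (key.const_add 1).congr_of_eventuallyEq ?_
    filter_upwards [eventually_gt_nhds hs] with y hy
    rw [mlR_one_eq_one_add_tsum ha0 ha1]
    rw [tsum_congr (hterm hy)]
  · have hy0 : 0 < y := by linarith [hy.1]
    have hG := (Real.Gamma_pos_of_pos (hpos k)).ne'
    have hk := (hpos k).ne'
    convert! (Real.hasDerivAt_rpow_const (p := (k : ℝ) * a + a) (Or.inl hy0.ne')).const_mul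
      ((-c) ^ (k + 1) / Real.Gamma ((k : ℝ) * a + a + 1)) using 1
    rw [Real.Gamma_add_one hk]
    field_simp
  · have hy0 : 0 < y := by linarith [hy.1]
    have hG := Real.Gamma_pos_of_pos (hpos k)
    rw [Real.rpow_sub_one hy0.ne', ← hpow hy0, norm_mul, norm_div, norm_div, norm_pow, norm_pow,
      norm_neg, Real.norm_eq_abs, Real.norm_eq_abs, Real.norm_eq_abs, Real.norm_eq_abs,
      abs_of_pos hG, abs_of_pos hy0, abs_of_pos (Real.rpow_pos_of_pos hy0 a)]
    calc |c| ^ (k + 1) / Real.Gamma ((k : ℝ) * a + a) * ((y ^ a) ^ (k + 1) / y)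
        ≤ |c| ^ (k + 1) / Real.Gamma ((k : ℝ) * a + a) *
          (((2 * s) ^ a) ^ (k + 1) / (s / 2)) := by
          gcongr
          · exact hy.2.le
          · exact hy.1.le
      _ = _ := by ring

/-- `u(t) = E_{α,1}(−λ t^α)` solves the Caputo fractional ODE `∂_t^α u = −λ u`, `u(0) = 1`. -/
theorem stmt_6 (α lam : ℝ) (hα : α ∈ Set.Ioo (0:ℝ) 1) :
    mlR α 1 (-(lam * (0:ℝ) ^ α)) = 1 ∧
    ∀ t : ℝ, 0 < t →
      caputoR α (fun s => mlR α 1 (-(lam * s ^ α))) t = -lam * mlR α 1 (-(lam * t ^ α)) := by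
  obtain ⟨hα0, hα1⟩ := hα
  refine ⟨?_, fun t ht => ?_⟩
  · simp [mlR_one_eq_one_add_tsum hα0 hα1, Real.zero_rpow hα0.ne']
  have hpos (k : ℕ) : 0 < (k : ℝ) * α + α := by positivity
  have hΓ : 0 < Real.Gamma (1 - α) := Real.Gamma_pos_of_pos (sub_pos.2 hα1)
  have hint (k : ℕ) :
      ∫ s in (0:ℝ)..t, s ^ ((k : ℝ) * α + α - 1) * (t - s) ^ (-α) =
        (t ^ α) ^ k * (Real.Gamma ((k : ℝ) * α + α) * Real.Gamma (1 - α) /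
          Real.Gamma ((k : ℝ) * α + 1)) := by
    have h := integral_rpow_mul_sub_rpow (hpos k) (sub_pos.2 hα1) ht
    rw [show 1 - α - 1 = -α by ring, show (k : ℝ) * α + α + (1 - α) = k * α + 1 by ring,
      add_sub_cancel_right] at h
    rw [h, ← Real.rpow_natCast, ← Real.rpow_mul ht.le, mul_comm α]
  have hii (k : ℕ) : IntervalIntegrable
      (fun s : ℝ => s ^ ((k : ℝ) * α + α - 1) * (t - s) ^ (-α)) volume 0 t := by
    refine intervalIntegral.intervalIntegrable_of_integral_ne_zero ?_
    rw [hint k]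
    have := Real.Gamma_pos_of_pos (hpos k)
    have : 0 < Real.Gamma ((k : ℝ) * α + 1) := Real.Gamma_pos_of_pos (by positivity)
    positivity
  let F : ℕ → ℝ → ℝ := fun k s =>
    (-lam) ^ (k + 1) / Real.Gamma ((k : ℝ) * α + α) *
      (s ^ ((k : ℝ) * α + α - 1) * (t - s) ^ (-α))
  have hF_int (k : ℕ) : Integrable (F k) (volume.restrict (Ioc 0 t)) :=
    ((intervalIntegrable_iff_integrableOn_Ioc_of_le ht.le).1 (hii k)).const_mul _
  have hFval (c : ℝ) (k : ℕ) :
      ∫ s in Ioc 0 t, c ^ (k + 1) / Real.Gamma ((k : ℝ) * α + α) *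
        (s ^ ((k : ℝ) * α + α - 1) * (t - s) ^ (-α)) =
      (c * t ^ α) ^ k / Real.Gamma ((k : ℝ) * α + 1) * (c * Real.Gamma (1 - α)) := by
    have := (Real.Gamma_pos_of_pos (hpos k)).ne'
    rw [integral_const_mul, ← intervalIntegral.integral_of_le ht.le, hint k]
    field_simp
    ring
  have hF_norm (k : ℕ) : ∫ s in Ioc 0 t, ‖F k s‖ =
      (|lam| * t ^ α) ^ k / Real.Gamma ((k : ℝ) * α + 1) * (|lam| * Real.Gamma (1 - α)) := by
    rw [← hFval]
    refine setIntegral_congr_fun measurableSet_Ioc fun s hs => ?_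
    simp only [F, norm_mul, norm_div, norm_pow, norm_neg, Real.norm_eq_abs]
    rw [abs_of_pos (Real.Gamma_pos_of_pos (hpos k)),
      abs_of_nonneg (Real.rpow_nonneg hs.1.le _),
      abs_of_nonneg (Real.rpow_nonneg (sub_nonneg.2 hs.2) _)]
  have hswap := hasSum_integral_of_summable_integral_norm hF_int (by
    simp only [hF_norm]
    exact (summable_pow_div_Gamma_s6 hα0 hα1 one_pos _).mul_right _)
  have hderiv : ∫ s in (0:ℝ)..t, (t - s) ^ (-α) * deriv (fun s => mlR α 1 (-(lam * s ^ α))) s =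
      ∫ s in Ioc 0 t, ∑' k, F k s := by
    rw [intervalIntegral.integral_of_le ht.le]
    refine setIntegral_congr_fun measurableSet_Ioc fun s hs => ?_
    simp only [F]
    rw [(hasDerivAt_mlR_neg_mul_rpow hα0 hα1 lam hs.1).deriv, ← tsum_mul_left]
    exact tsum_congr fun k => by ring
  rw [caputoR, hderiv, ← hswap.tsum_eq]
  simp only [F, hFval]
  rw [tsum_mul_right, mlR]
  simp only [neg_mul]
  field_simp
end
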